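/- Assume hypotheses (R1) and (L1). Then for each j ∈ {1,…,n−1}, at every point of L the fifth-derivative identity u_{n̄jn̄jj̄} = 2 (u_{nn̄})^{−1} u_{nj̄n̄} u_{jn̄n̄j} + 2 (u_{nn̄})^{−2} u_{jn̄n̄} u_{nj̄n} u_{jn̄n̄} holds. -/

import Mathlib

open Complex
open scoped ComplexOrder

/-- Wirtinger derivative in direction `d.1`; `d.2 = true` means `∂/∂z̄`, `false` means `∂/∂z`. -/
noncomputable def wd {n : ℕ} (d : Fin n × Bool) (f : (Fin n → ℂ) → ℂ) : (Fin n → ℂ) → ℂ :=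
  fun z => (1/2 : ℂ) * (fderiv ℝ f z (Pi.single d.1 1) +
      (if d.2 then Complex.I else -Complex.I) * fderiv ℝ f z (Pi.single d.1 Complex.I))

/-- Iterated Wirtinger derivative: differentiate in the listed directions, left to right. -/
noncomputable def wderiv {n : ℕ} (l : List (Fin n × Bool)) (f : (Fin n → ℂ) → ℂ) :
    (Fin n → ℂ) → ℂ :=
  l.foldl (fun g d => wd d g) f

/-- The real function `u` viewed as a complex-valued function. -/
def cplx {n : ℕ} (u : (Fin n → ℂ) → ℝ) : (Fin n → ℂ) → ℂ := fun z => (u z : ℂ)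

/-- Levi matrix entry `u_{jk̄} = ∂²u/∂z_j∂z̄_k`. -/
noncomputable def levi {n : ℕ} (u : (Fin n → ℂ) → ℝ) (j k : Fin n) : (Fin n → ℂ) → ℂ :=
  wderiv [(j, false), (k, true)] (cplx u)

section helpers

variable {n : ℕ} {U : Set (Fin n → ℂ)}

lemma wd_smooth (hU : IsOpen U) {f : (Fin n → ℂ) → ℂ} (hf : ContDiffOn ℝ (⊤ : ℕ∞) f U)
    (d : Fin n × Bool) : ContDiffOn ℝ (⊤ : ℕ∞) (wd d f) U := by
  have h1 : ContDiffOn ℝ (⊤ : ℕ∞) (fderiv ℝ f) U := hf.fderiv_of_isOpen hU (by simp)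
  unfold wd
  exact contDiffOn_const.mul ((h1.clm_apply contDiffOn_const).add
    (contDiffOn_const.mul (h1.clm_apply contDiffOn_const)))

lemma smooth_diffAt (hU : IsOpen U) {f : (Fin n → ℂ) → ℂ} (hf : ContDiffOn ℝ (⊤ : ℕ∞) f U)
    {z : Fin n → ℂ} (hz : z ∈ U) : DifferentiableAt ℝ f z :=
  (hf.contDiffAt (hU.mem_nhds hz)).differentiableAt (by simp)

lemma wd_mul (hU : IsOpen U) {f g : (Fin n → ℂ) → ℂ} (hf : ContDiffOn ℝ (⊤ : ℕ∞) f U)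
    (hg : ContDiffOn ℝ (⊤ : ℕ∞) g U) (d : Fin n × Bool) {z : Fin n → ℂ} (hz : z ∈ U) :
    wd d (fun z => f z * g z) z = wd d f z * g z + f z * wd d g z := by
  have := fderiv_fun_mul (smooth_diffAt hU hf hz) (smooth_diffAt hU hg hz)
  simp only [wd, this, add_apply, smul_apply, smul_eq_mul]
  ring

lemma wd_add (hU : IsOpen U) {f g : (Fin n → ℂ) → ℂ} (hf : ContDiffOn ℝ (⊤ : ℕ∞) f U)
    (hg : ContDiffOn ℝ (⊤ : ℕ∞) g U) (d : Fin n × Bool) {z : Fin n → ℂ} (hz : z ∈ U) :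
    wd d (fun z => f z + g z) z = wd d f z + wd d g z := by
  have := fderiv_fun_add (smooth_diffAt hU hf hz) (smooth_diffAt hU hg hz)
  simp only [wd, this, add_apply]
  ring

lemma wd_congr (hU : IsOpen U) {f g : (Fin n → ℂ) → ℂ} (h : ∀ z ∈ U, f z = g z)
    (d : Fin n × Bool) : ∀ z ∈ U, wd d f z = wd d g z := by
  intro z hz
  have : f =ᶠ[nhds z] g := Filter.eventually_of_mem (hU.mem_nhds hz) h
  simp only [wd, this.fderiv_eq]

lemma fderiv_wd (hU : IsOpen U) {f : (Fin n → ℂ) → ℂ} (hf : ContDiffOn ℝ (⊤ : ℕ∞) f U)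
    (d : Fin n × Bool) {z : Fin n → ℂ} (hz : z ∈ U) (v : Fin n → ℂ) :
    fderiv ℝ (wd d f) z v = (1/2 : ℂ) * (fderiv ℝ (fderiv ℝ f) z v (Pi.single d.1 1) +
      (if d.2 then Complex.I else -Complex.I) *
        fderiv ℝ (fderiv ℝ f) z v (Pi.single d.1 Complex.I)) := by
  have h1 : ContDiffOn ℝ (⊤ : ℕ∞) (fderiv ℝ f) U := hf.fderiv_of_isOpen hU (by simp)
  have h2 : DifferentiableAt ℝ (fderiv ℝ f) z :=
    (h1.contDiffAt (hU.mem_nhds hz)).differentiableAt (by simp)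
  have h3 (w : Fin n → ℂ) : HasFDerivAt (fun y => fderiv ℝ f y w)
      ((fderiv ℝ (fderiv ℝ f) z).flip w) z := by
    have := h2.hasFDerivAt.clm_apply (hasFDerivAt_const w z)
    refine this.congr_fderiv ?_
    ext; simp
  have h4 := ((h3 (Pi.single d.1 1)).add ((h3 (Pi.single d.1 Complex.I)).const_mul
    (if d.2 then Complex.I else -Complex.I))).const_mul (1/2 : ℂ)
  have h5 : HasFDerivAt (wd d f) _ z := h4
  rw [h5.fderiv]
  simp only [add_apply, smul_apply, ContinuousLinearMap.flip_apply, smul_eq_mul]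

lemma wd_comm (hU : IsOpen U) {f : (Fin n → ℂ) → ℂ} (hf : ContDiffOn ℝ (⊤ : ℕ∞) f U)
    (d e : Fin n × Bool) : ∀ z ∈ U, wd d (wd e f) z = wd e (wd d f) z := by
  intro z hz
  have hs : IsSymmSndFDerivAt ℝ f z :=
    (hf.contDiffAt (hU.mem_nhds hz)).isSymmSndFDerivAt
      (by simp only [minSmoothness_of_isRCLikeNormedField]; exact WithTop.coe_le_coe.mpr (le_top : (2 : ℕ∞) ≤ ⊤))
  have key : ∀ d e : Fin n × Bool, wd d (wd e f) z = (1/2 : ℂ) *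
      (fderiv ℝ (wd e f) z (Pi.single d.1 1) + (if d.2 then Complex.I else -Complex.I) *
        fderiv ℝ (wd e f) z (Pi.single d.1 Complex.I)) := fun _ _ => rfl
  rw [key, key]
  simp only [fderiv_wd hU hf _ hz]
  rw [hs (Pi.single d.1 1) (Pi.single e.1 1), hs (Pi.single d.1 1) (Pi.single e.1 Complex.I),
    hs (Pi.single d.1 Complex.I) (Pi.single e.1 1),
    hs (Pi.single d.1 Complex.I) (Pi.single e.1 Complex.I)]
  ring

lemma wderiv_congr (hU : IsOpen U) (l : List (Fin n × Bool)) : ∀ {f g : (Fin n → ℂ) → ℂ},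
    (∀ z ∈ U, f z = g z) → ∀ z ∈ U, wderiv l f z = wderiv l g z := by
  induction l with
  | nil => intro f g h; exact h
  | cons d l ih => intro f g h; exact ih (wd_congr hU h d)

lemma wderiv_smooth (hU : IsOpen U) (l : List (Fin n × Bool)) : ∀ {f : (Fin n → ℂ) → ℂ},
    ContDiffOn ℝ (⊤ : ℕ∞) f U → ContDiffOn ℝ (⊤ : ℕ∞) (wderiv l f) U := by
  induction l with
  | nil => intro f h; exact h
  | cons d l ih => intro f h; exact ih (wd_smooth hU h d)

lemma wderiv_perm (hU : IsOpen U) {l l' : List (Fin n × Bool)} (h : l.Perm l') :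
    ∀ {f : (Fin n → ℂ) → ℂ}, ContDiffOn ℝ (⊤ : ℕ∞) f U →
      ∀ z ∈ U, wderiv l f z = wderiv l' f z := by
  induction h with
  | nil => intro f hf z hz; rfl
  | cons d _ ih => intro f hf; exact ih (wd_smooth hU hf d)
  | swap d e l => intro f hf; exact wderiv_congr hU l (wd_comm hU hf d e)
  | trans _ _ ih1 ih2 => intro f hf z hz; exact (ih1 hf z hz).trans (ih2 hf z hz)

lemma wd_tangent (hU : IsOpen U) {p j : Fin n} (hj : j ≠ p) {f : (Fin n → ℂ) → ℂ}
    (hf : ContDiffOn ℝ (⊤ : ℕ∞) f U) (h : ∀ z ∈ U, z p = 0 → f z = 0) (b : Bool) :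
    ∀ z ∈ U, z p = 0 → wd (j, b) f z = 0 := by
  intro z hz hp
  have key : ∀ c : ℂ, fderiv ℝ f z (Pi.single j c) = 0 := by
    intro c
    rw [← (smooth_diffAt hU hf hz).lineDeriv_eq_fderiv]
    have hc : Continuous (fun t : ℝ => z + t • (Pi.single j c : Fin n → ℂ)) := by fun_prop
    have hev : (fun t : ℝ => f (z + t • (Pi.single j c : Fin n → ℂ))) =ᶠ[nhds 0] fun _ => 0 := by
      have hm : (fun t : ℝ => z + t • (Pi.single j c : Fin n → ℂ)) ⁻¹' U ∈ nhds (0 : ℝ) :=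
        (hU.preimage hc).mem_nhds (by simpa using hz)
      filter_upwards [hm] with t ht
      exact h _ ht (by simp [hp, hj.symm])
    rw [lineDeriv, hev.deriv_eq]
    simp
  simp [wd, key]

/-- First-order Leibniz consequence of `a g = b c`. -/
lemma leib1 (hU : IsOpen U) {a g b c : (Fin n → ℂ) → ℂ} (ha : ContDiffOn ℝ (⊤ : ℕ∞) a U)
    (hg : ContDiffOn ℝ (⊤ : ℕ∞) g U) (hb : ContDiffOn ℝ (⊤ : ℕ∞) b U)
    (hc : ContDiffOn ℝ (⊤ : ℕ∞) c U) (h : ∀ z ∈ U, a z * g z = b z * c z) (d : Fin n × Bool) :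
    ∀ z ∈ U, wd d a z * g z + a z * wd d g z = wd d b z * c z + b z * wd d c z := by
  intro z hz
  rw [← wd_mul hU ha hg d hz, ← wd_mul hU hb hc d hz]
  exact wd_congr hU h d z hz

/-- Second-order Leibniz consequence of `a g = b c`. -/
lemma leib2 (hU : IsOpen U) {a g b c : (Fin n → ℂ) → ℂ} (ha : ContDiffOn ℝ (⊤ : ℕ∞) a U)
    (hg : ContDiffOn ℝ (⊤ : ℕ∞) g U) (hb : ContDiffOn ℝ (⊤ : ℕ∞) b U)
    (hc : ContDiffOn ℝ (⊤ : ℕ∞) c U) (h : ∀ z ∈ U, a z * g z = b z * c z) (d e : Fin n × Bool) :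
    ∀ z ∈ U, wd e (wd d a) z * g z + wd d a z * wd e g z
        + (wd e a z * wd d g z + a z * wd e (wd d g) z)
      = wd e (wd d b) z * c z + wd d b z * wd e c z
        + (wd e b z * wd d c z + b z * wd e (wd d c) z) := by
  intro z hz
  have ha' := wd_smooth hU ha d
  have hg' := wd_smooth hU hg d
  have hb' := wd_smooth hU hb d
  have hc' := wd_smooth hU hc d
  have := wd_congr hU (leib1 hU ha hg hb hc h d) e z hz
  rwa [wd_add hU (ha'.mul hg) (ha.mul hg') e hz, wd_add hU (hb'.mul hc) (hb.mul hc') e hz,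
    wd_mul hU ha' hg e hz, wd_mul hU ha hg' e hz, wd_mul hU hb' hc e hz,
    wd_mul hU hb hc' e hz] at this

end helpers

/-- under (R1) and (L1), along L = {z_n = 0} the fifth-derivative identity
u_{n̄jn̄jj̄} = 2 (u_{nn̄})⁻¹ u_{nj̄n̄} u_{jn̄n̄j} + 2 (u_{nn̄})⁻² u_{jn̄n̄} u_{nj̄n} u_{jn̄n̄} holds. -/
theorem stmt_7 {m : ℕ} (hm : 1 ≤ m) (U : Set (Fin (m+1) → ℂ)) (hU : IsOpen U)
    (u : (Fin (m+1) → ℂ) → ℝ) (hsmooth : ContDiffOn ℝ (⊤ : ℕ∞) u U)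
    (hR1 : ∀ z ∈ U, ∀ j k : Fin (m+1), j ≠ Fin.last m → k ≠ Fin.last m →
      levi u j k z * levi u (Fin.last m) (Fin.last m) z
        - levi u j (Fin.last m) z * levi u (Fin.last m) k z = 0)
    (hL1 : ∀ z ∈ U, z (Fin.last m) = 0 →
      (∀ j k : Fin (m+1), (j, k) ≠ (Fin.last m, Fin.last m) → levi u j k z = 0) ∧
      0 < (levi u (Fin.last m) (Fin.last m) z).re ∧
      (levi u (Fin.last m) (Fin.last m) z).im = 0) :
    ∀ z ∈ U, z (Fin.last m) = 0 → ∀ j : Fin (m+1), j ≠ Fin.last m →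
      wderiv [(Fin.last m, true), (j, false), (Fin.last m, true), (j, false), (j, true)]
          (cplx u) z
        = 2 * (levi u (Fin.last m) (Fin.last m) z)⁻¹
            * wderiv [(Fin.last m, false), (j, true), (Fin.last m, true)] (cplx u) z
            * wderiv [(j, false), (Fin.last m, true), (Fin.last m, true), (j, false)] (cplx u) z
          + 2 * ((levi u (Fin.last m) (Fin.last m) z)⁻¹) ^ 2
            * wderiv [(j, false), (Fin.last m, true), (Fin.last m, true)] (cplx u) z
            * wderiv [(Fin.last m, false), (j, true), (Fin.last m, false)] (cplx u) z
            * wderiv [(j, false), (Fin.last m, true), (Fin.last m, true)] (cplx u) z := by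
  intro z hz hz0 j hj
  have hu : ContDiffOn ℝ (⊤ : ℕ∞) (cplx u) U :=
    Complex.ofRealCLM.contDiff.comp_contDiffOn hsmooth
  generalize Fin.last m = p at *
  have hS : ∀ l, ContDiffOn ℝ (⊤ : ℕ∞) (wderiv l (cplx u)) U := fun l => wderiv_smooth hU l hu
  have ha : ContDiffOn ℝ (⊤ : ℕ∞) (levi u j j) U := hS _
  have hg : ContDiffOn ℝ (⊤ : ℕ∞) (levi u p p) U := hS _
  have hb : ContDiffOn ℝ (⊤ : ℕ∞) (levi u j p) U := hS _
  have hc : ContDiffOn ℝ (⊤ : ℕ∞) (levi u p j) U := hS _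
  have E0 : ∀ z ∈ U, levi u j j z * levi u p p z = levi u j p z * levi u p j z :=
    fun z hz => sub_eq_zero.mp (hR1 z hz j j hj hj)
  have a0 : ∀ z ∈ U, z p = 0 → levi u j j z = 0 :=
    fun z hz h0 => (hL1 z hz h0).1 j j (by simp [hj])
  have b0 : ∀ z ∈ U, z p = 0 → levi u j p z = 0 :=
    fun z hz h0 => (hL1 z hz h0).1 j p (by simp [hj])
  have c0 : ∀ z ∈ U, z p = 0 → levi u p j z = 0 :=
    fun z hz h0 => (hL1 z hz h0).1 p j (by simp [hj])
  have g0 : ∀ z ∈ U, z p = 0 → levi u p p z ≠ 0 := by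
    intro z hz h0 h
    have := (hL1 z hz h0).2.1
    simp [h] at this
  -- first normal derivatives of `a` vanish on the leaf
  have a1 : ∀ b, ∀ z ∈ U, z p = 0 → wd (p, b) (levi u j j) z = 0 := by
    intro b z hz h0
    have := leib1 hU ha hg hb hc E0 (p, b) z hz
    rw [a0 z hz h0, b0 z hz h0, c0 z hz h0] at this
    simpa [g0 z hz h0] using this
  have a2 : ∀ z ∈ U, z p = 0 →
      wd (p, true) (wd (p, true) (levi u j j)) z * levi u p p z
        = wd (p, true) (levi u j p) z * wd (p, true) (levi u p j) z
          + wd (p, true) (levi u j p) z * wd (p, true) (levi u p j) z := by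
    intro z hz h0
    have := leib2 hU ha hg hb hc E0 (p, true) (p, true) z hz
    rw [a0 z hz h0, b0 z hz h0, c0 z hz h0, a1 _ z hz h0] at this
    simpa using this
  have a3 : wd (p, false) (wd (p, true) (levi u j j)) z * levi u p p z
        = wd (p, true) (levi u j p) z * wd (p, false) (levi u p j) z
          + wd (p, false) (levi u j p) z * wd (p, true) (levi u p j) z := by
    have := leib2 hU ha hg hb hc E0 (p, true) (p, false) z hz
    rw [a0 z hz hz0, b0 z hz hz0, c0 z hz hz0, a1 _ z hz hz0, a1 _ z hz hz0] at this
    simpa using this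
  -- tangential derivative of `a2`
  have hann := wd_smooth hU (wd_smooth hU ha (p, true)) (p, true)
  have hbn := wd_smooth hU hb (p, true)
  have hcn := wd_smooth hU hc (p, true)
  have hm2 : ContDiffOn ℝ (⊤ : ℕ∞) (fun _ : Fin (m+1) → ℂ => (-2 : ℂ)) U := contDiffOn_const
  have T := wd_tangent hU hj (f := fun z =>
      wd (p, true) (wd (p, true) (levi u j j)) z * levi u p p z
        + (-2) * (wd (p, true) (levi u j p) z * wd (p, true) (levi u p j) z))
    ((hann.mul hg).add (hm2.mul (hbn.mul hcn)))
    (fun z hz h0 => by rw [a2 z hz h0]; ring) false z hz hz0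
  have hconst : wd (j, false) (fun _ : Fin (m+1) → ℂ => (-2 : ℂ)) z = 0 := by simp [wd]
  rw [wd_add hU (hann.mul hg) (hm2.mul (hbn.mul hcn)) _ hz, wd_mul hU hann hg _ hz,
    wd_mul hU hm2 (hbn.mul hcn) _ hz, wd_mul hU hbn hcn _ hz, hconst] at T
  have A2 := a2 z hz hz0
  have G := g0 z hz hz0
  -- symmetry of mixed derivatives
  have s1 : wderiv [(p, true), (j, false), (p, true), (j, false), (j, true)] (cplx u) z
      = wd (j, false) (wd (p, true) (wd (p, true) (levi u j j))) z :=
    wderiv_perm hU (l' := [(j, false), (j, true), (p, true), (p, true), (j, false)])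
      (by rw [List.perm_iff_count]; intro x; simp only [List.count_cons]; ring) hu z hz
  have s2 : wd (j, false) (wd (p, true) (levi u p j)) z
      = wd (p, false) (wd (p, true) (levi u j j)) z :=
    wderiv_perm hU (l := [(p, false), (j, true), (p, true), (j, false)])
      (l' := [(j, false), (j, true), (p, true), (p, false)])
      (by rw [List.perm_iff_count]; intro x; simp only [List.count_cons]; ring) hu z hz
  have s3 : wd (j, false) (levi u p p) z = wd (p, false) (levi u j p) z :=
    wderiv_perm hU (l := [(p, false), (p, true), (j, false)])
      (l' := [(j, false), (p, true), (p, false)])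
      (by rw [List.perm_iff_count]; intro x; simp only [List.count_cons]; ring) hu z hz
  rw [s1]
  change _ = 2 * (levi u p p z)⁻¹ * wd (p, true) (levi u p j) z
        * wd (j, false) (wd (p, true) (levi u j p)) z
      + 2 * ((levi u p p z)⁻¹) ^ 2 * wd (p, true) (levi u j p) z
        * wd (p, false) (levi u p j) z * wd (p, true) (levi u j p) z
  rw [s2, s3] at T
  generalize wd (j, false) (wd (p, true) (wd (p, true) (levi u j j))) z = X at *
  generalize wd (p, true) (wd (p, true) (levi u j j)) z = ann at *
  generalize wd (p, false) (wd (p, true) (levi u j j)) z = anm at *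
  generalize wd (j, false) (wd (p, true) (levi u j p)) z = bnj at *
  generalize wd (p, true) (levi u j p) z = bn at *
  generalize wd (p, false) (levi u j p) z = bm at *
  generalize wd (p, true) (levi u p j) z = cn at *
  generalize wd (p, false) (levi u p j) z = cm at *
  generalize levi u p p z = g at *
  field_simp
  linear_combination g * T - bm * A2 + 2 * bn * a3
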